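/- Let H be a complex Hilbert space, A and B self-adjoint operators on H, and q = e^{−iθ₀} with 0 < |θ₀| < π (so q² ≠ 1). Set q^{1/2} := e^{−iθ₀/2} and q̄^{1/2} := e^{iθ₀/2}. Fix a, b ∈ ℝ with ab ≠ 0, assume D_q(A,B) is dense in H, and define T on D(T) := D_q(A,B) by Tf := q̄^{1/2}(A − a q^{1/2} I)(B − b q^{1/2} I)f + ((q̄^{1/2} − q^{1/2})/2) ab f. If T is essentially self-adjoint (its closure is self-adjoint), then, with λ := a q̄^{1/2} and μ := b q̄^{1/2} (these satisfy λ, λq ∈ ρ(A) and μ, μq ∈ ρ(B) since they are non-real), the following hold for all h ∈ H: R_λ(A)R_μ(B)h = q R_{μq}(B)R_{λq}(A)h + ab(q − 1) R_{μq}(B)R_{λq}(A)R_λ(A)R_μ(B)h, and R_λ(A)R_μ(B)h = q R_{μq}(B)R_{λq}(A)h + ab(q − 1) R_λ(A)R_μ(B)R_{μq}(B)R_{λq}(A)h; moreover, the bounded operator R_{b q^{1/2}}(B) R_{a q^{1/2}}(A) is normal. -/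

import Mathlib

open scoped InnerProductSpace

/-- `R` is the (everywhere-defined bounded) resolvent of the linear partial map `T`
at the point `lam`; the existence of such an `R` means `lam ∈ ρ(T)`. -/
def IsResolventAt {H : Type*} [NormedAddCommGroup H] [InnerProductSpace ℂ H]
    (T : H →ₗ.[ℂ] H) (lam : ℂ) (R : H →L[ℂ] H) : Prop :=
  (∀ h : H, ∃ hm : R h ∈ T.domain, T ⟨R h, hm⟩ - lam • R h = h) ∧
    ∀ f : T.domain, R (T f - lam • (f : H)) = f

/-- The set `D_q(A,B)` of all `f ∈ D(AB) ∩ D(BA)` with `ABf = q • BAf`. -/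
def qCommSet {H : Type*} [NormedAddCommGroup H] [InnerProductSpace ℂ H]
    (A B : H →ₗ.[ℂ] H) (q : ℂ) : Set H :=
  {f | ∃ (hfB : f ∈ B.domain) (hfA : f ∈ A.domain)
      (hBf : B ⟨f, hfB⟩ ∈ A.domain) (hAf : A ⟨f, hfA⟩ ∈ B.domain),
      A ⟨B ⟨f, hfB⟩, hBf⟩ = q • B ⟨A ⟨f, hfA⟩, hAf⟩}

/-- The value `T f = q̄^{1/2}(A - a q^{1/2} I)(B - b q^{1/2} I) f + ((q̄^{1/2} - q^{1/2})/2) ab f`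
for `f ∈ D(A) ∩ D(B)` with `B f ∈ D(A)`; here `q^{1/2} = e^{-iθ₀/2}`, `q̄^{1/2} = e^{iθ₀/2}`
and `q = e^{-iθ₀}`. -/
noncomputable def Tval {H : Type*} [NormedAddCommGroup H] [InnerProductSpace ℂ H]
    (A B : H →ₗ.[ℂ] H) (θ₀ : ℝ) (a b : ℝ) (f : H)
    (hfB : f ∈ B.domain) (hfA : f ∈ A.domain) (hBf : B ⟨f, hfB⟩ ∈ A.domain) : H :=
  Complex.exp ((θ₀ / 2 : ℝ) * Complex.I) •
      (A ⟨B ⟨f, hfB⟩, hBf⟩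
        - ((b : ℂ) * Complex.exp (-(θ₀ / 2 : ℝ) * Complex.I)) • A ⟨f, hfA⟩
        - ((a : ℂ) * Complex.exp (-(θ₀ / 2 : ℝ) * Complex.I)) • B ⟨f, hfB⟩
        + ((a : ℂ) * (b : ℂ) * Complex.exp (-(θ₀ : ℝ) * Complex.I)) • f)
    + (((Complex.exp ((θ₀ / 2 : ℝ) * Complex.I) - Complex.exp (-(θ₀ / 2 : ℝ) * Complex.I)) / 2)
        * ((a : ℂ) * (b : ℂ))) • f

/-- The graph of the operator `T` of Statement 14, whose domain is `D_q(A,B)`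
with `q = e^{-iθ₀}`. -/
def TGraph {H : Type*} [NormedAddCommGroup H] [InnerProductSpace ℂ H]
    (A B : H →ₗ.[ℂ] H) (θ₀ : ℝ) (a b : ℝ) : Set (H × H) :=
  {p | ∃ (f : H) (hfB : f ∈ B.domain) (hfA : f ∈ A.domain)
      (hBf : B ⟨f, hfB⟩ ∈ A.domain) (hAf : A ⟨f, hfA⟩ ∈ B.domain),
      A ⟨B ⟨f, hfB⟩, hBf⟩ = Complex.exp (-(θ₀ : ℝ) * Complex.I) • B ⟨A ⟨f, hfA⟩, hAf⟩ ∧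
      p = (f, Tval A B θ₀ a b f hfB hfA hBf)}

/-- A self-adjoint operator is symmetric. -/
lemma selfAdj_symm {H : Type*} [NormedAddCommGroup H] [InnerProductSpace ℂ H] [CompleteSpace H]
    (A : H →ₗ.[ℂ] H) (hA : IsSelfAdjoint A) (x y : A.domain) :
    ⟪A x, (y : H)⟫_ℂ = ⟪(x : H), A y⟫_ℂ := by
  have h := LinearPMap.adjoint_isFormalAdjoint (T := A) hA.dense_domain
  rw [LinearPMap.isSelfAdjoint_def.mp hA] at h
  exact h x y

/-- Lower bound for `A - z`. -/
lemma selfAdj_bound {H : Type*} [NormedAddCommGroup H] [InnerProductSpace ℂ H] [CompleteSpace H]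
    (A : H →ₗ.[ℂ] H) (hA : IsSelfAdjoint A) (z : ℂ) (f : A.domain) :
    |z.im| * ‖(f : H)‖ ≤ ‖A f - z • (f : H)‖ := by
  by_cases hf : ‖(f : H)‖ = 0
  · rw [hf]; simp
  have hreal : (⟪(f : H), A f⟫_ℂ).im = 0 := by
    have h1 : (starRingEnd ℂ) ⟪(f : H), A f⟫_ℂ = ⟪(f : H), A f⟫_ℂ := by
      rw [inner_conj_symm]; exact selfAdj_symm A hA f f
    exact Complex.conj_eq_iff_im.mp h1
  have h2 : (⟪(f : H), A f - z • (f : H)⟫_ℂ).im = - (z.im * ‖(f : H)‖ ^ 2) := by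
    rw [inner_sub_right, inner_smul_right, inner_self_eq_norm_sq_to_K, Complex.sub_im, hreal]
    have : ((‖(f : H)‖ : ℂ) ^ 2) = ((‖(f : H)‖ ^ 2 : ℝ) : ℂ) := by push_cast; rfl
    simp only [Complex.coe_algebraMap, this, Complex.im_mul_ofReal]
    ring
  have h3 : |z.im| * ‖(f : H)‖ ^ 2 ≤ ‖(f : H)‖ * ‖A f - z • (f : H)‖ := by
    have h4 := (Complex.abs_im_le_norm ⟪(f : H), A f - z • (f : H)⟫_ℂ).trans
      (norm_inner_le_norm _ _)
    rw [h2, abs_neg, abs_mul, abs_of_nonneg (sq_nonneg ‖(f : H)‖)] at h4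
    exact h4
  have hpos : 0 < ‖(f : H)‖ := lt_of_le_of_ne (norm_nonneg _) (Ne.symm hf)
  nlinarith

/-- Non-real numbers are in the resolvent set of a self-adjoint operator. -/
lemma selfAdj_resolvent {H : Type*} [NormedAddCommGroup H] [InnerProductSpace ℂ H]
    [CompleteSpace H] (A : H →ₗ.[ℂ] H) (hA : IsSelfAdjoint A) (z : ℂ) (hz : z.im ≠ 0) :
    ∃ R, IsResolventAt A z R := by
  have hcl : IsClosed (A.graph : Set (H × H)) := hA.isClosed
  have : CompleteSpace A.graph := hcl.completeSpace_coe
  let φ : A.graph →L[ℂ] H :=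
    ((ContinuousLinearMap.snd ℂ H H) - z • (ContinuousLinearMap.fst ℂ H H)) ∘L A.graph.subtypeL
  have hφ : ∀ x : A.graph, φ x = x.1.2 - z • x.1.1 := fun x => rfl
  have hmk : ∀ f : A.domain, ((f : H), A f) ∈ A.graph := fun f => A.mem_graph f
  have hc : 0 < |z.im| := abs_pos.mpr hz
  have hb1 : ∀ x : A.graph, ‖x.1.1‖ ≤ |z.im|⁻¹ * ‖φ x‖ := by
    rintro ⟨⟨f, g⟩, hx⟩
    obtain ⟨f', rfl, rfl⟩ := (LinearPMap.mem_graph_iff A).mp hx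
    have := selfAdj_bound A hA z f'
    rw [hφ, inv_mul_eq_div, le_div_iff₀ hc]
    linarith
  have hb : ∀ x : A.graph, ‖x‖ ≤ (1 + (1 + ‖z‖) * |z.im|⁻¹) * ‖φ x‖ := by
    intro x
    have h1 := hb1 x
    have h2 : ‖x.1.2‖ ≤ ‖φ x‖ + ‖z‖ * ‖x.1.1‖ := by
      have : x.1.2 = φ x + z • x.1.1 := by rw [hφ]; abel
      rw [← norm_smul]
      conv_lhs => rw [this]
      exact norm_add_le _ _
    have h3 : ‖z‖ * ‖x.1.1‖ ≤ ‖z‖ * (|z.im|⁻¹ * ‖φ x‖) := by gcongr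
    have h4 : 0 ≤ |z.im|⁻¹ * ‖φ x‖ := by positivity
    have h5 : 0 ≤ ‖z‖ * (|z.im|⁻¹ * ‖φ x‖) := by positivity
    have h6 : 0 ≤ ‖φ x‖ := norm_nonneg _
    have h7 : ‖x‖ = max ‖x.1.1‖ ‖x.1.2‖ := rfl
    rw [h7]
    apply max_le <;> nlinarith
  have hanti := φ.antilipschitz_of_bound (K := ⟨1 + (1 + ‖z‖) * |z.im|⁻¹, by positivity⟩) hb
  have hker : φ.ker = ⊥ := LinearMap.ker_eq_bot.mpr hanti.injective
  have hrcl : IsClosed (Set.range φ) := hanti.isClosed_range φ.uniformContinuous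
  have horth : (φ.range)ᗮ = ⊥ := by
    rw [Submodule.eq_bot_iff]
    intro h hh
    rw [Submodule.mem_orthogonal] at hh
    have h1 : ∀ f : A.domain, ⟪A f - z • (f : H), h⟫_ℂ = 0 := fun f =>
      hh _ ⟨⟨_, hmk f⟩, rfl⟩
    have h2 : ∀ f : A.domain, ⟪(starRingEnd ℂ) z • h, (f : H)⟫_ℂ = ⟪h, A f⟫_ℂ := by
      intro f
      have := h1 f
      rw [inner_sub_left, sub_eq_zero, inner_smul_left] at this
      rw [← inner_conj_symm h, this, inner_smul_left, map_mul, inner_conj_symm]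
    have hmem : h ∈ A.domain := by
      have := LinearPMap.mem_adjoint_domain_of_exists (T := A) h ⟨_, h2⟩
      rwa [LinearPMap.isSelfAdjoint_def.mp hA] at this
    have h3 := selfAdj_bound A hA ((starRingEnd ℂ) z) ⟨h, hmem⟩
    have h4 : A ⟨h, hmem⟩ - (starRingEnd ℂ) z • h = 0 := by
      refine hA.dense_domain.eq_zero_of_inner_left ℂ ?_
      intro v hv
      rw [inner_sub_left, h2 ⟨v, hv⟩]
      rw [selfAdj_symm A hA ⟨h, hmem⟩ ⟨v, hv⟩, sub_self]
    rw [h4, norm_zero, Complex.conj_im, abs_neg] at h3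
    have h5 : ‖h‖ = 0 := by
      have := norm_nonneg h
      have h3' : |z.im| * ‖h‖ ≤ 0 := h3
      nlinarith
    exact norm_eq_zero.mp h5
  have hrange : φ.range = ⊤ := by
    have h1 := Submodule.topologicalClosure_eq_top_iff.mpr horth
    rwa [IsClosed.submodule_topologicalClosure_eq] at h1
    exact hrcl
  let e := ContinuousLinearEquiv.ofBijective φ hker hrange
  refine ⟨(ContinuousLinearMap.fst ℂ H H) ∘L A.graph.subtypeL ∘L
    (e.symm : H →L[ℂ] A.graph), ?_, ?_⟩
  · intro h
    have h1 : φ (e.symm h) = h := e.apply_symm_apply h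
    obtain ⟨f', hf1, hf2⟩ := (LinearPMap.mem_graph_iff A).mp (e.symm h).2
    change ∃ hm : (e.symm h).1.1 ∈ A.domain, A ⟨(e.symm h).1.1, hm⟩ - z • (e.symm h).1.1 = h
    rw [hφ, ← hf1, ← hf2] at h1
    rw [← hf1]
    exact ⟨f'.2, h1⟩
  · intro f
    have h1 : e.symm (φ ⟨_, hmk f⟩) = ⟨_, hmk f⟩ := e.symm_apply_apply _
    have h2 := congrArg (fun x : A.graph => x.1.1) h1
    exact h2

/-- The adjoint of a resolvent is the resolvent at the conjugate point. -/
lemma resolvent_adjoint {H : Type*} [NormedAddCommGroup H] [InnerProductSpace ℂ H]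
    [CompleteSpace H] (A : H →ₗ.[ℂ] H) (hA : IsSelfAdjoint A) (z w : ℂ)
    (hw : (starRingEnd ℂ) z = w) (R S : H →L[ℂ] H)
    (hR : IsResolventAt A z R) (hS : IsResolventAt A w S) :
    ContinuousLinearMap.adjoint R = S := by
  symm
  rw [ContinuousLinearMap.eq_adjoint_iff]
  intro x y
  obtain ⟨hm, hx⟩ := hS.1 x
  obtain ⟨hn, hy⟩ := hR.1 y
  conv_lhs => rw [← hy]
  conv_rhs => rw [← hx]
  rw [inner_sub_left, inner_sub_right, inner_smul_left, inner_smul_right, ← hw, Complex.conj_conj]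
  rw [selfAdj_symm A hA ⟨S x, hm⟩ ⟨R y, hn⟩]

/-- Density of the range of an essentially self-adjoint operator shifted by an imaginary number. -/
lemma range_dense {H : Type*} [NormedAddCommGroup H] [InnerProductSpace ℂ H]
    [CompleteSpace H] (G : Set (H × H))
    (hG : closure G = {p : H × H | ∀ x ∈ G, ⟪x.2, p.1⟫_ℂ = ⟪x.1, p.2⟫_ℂ})
    (k : ℂ) (hk : (starRingEnd ℂ) k = -k) (hk0 : k ≠ 0) :
    Dense (Submodule.span ℂ ((fun x : H × H => x.2 - k • x.1) '' G) : Set H) := by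
  rw [Submodule.dense_iff_topologicalClosure_eq_top, Submodule.topologicalClosure_eq_top_iff,
    Submodule.eq_bot_iff]
  intro g hg
  rw [Submodule.mem_orthogonal] at hg
  have h1 : (g, (-k) • g) ∈ closure G := by
    rw [hG]
    intro x hx
    have := hg _ (Submodule.subset_span ⟨x, hx, rfl⟩)
    simp only [inner_sub_left, inner_smul_left, hk] at this
    simp only [inner_smul_right]
    linear_combination this
  have hsub : ∀ x ∈ closure G, ⟪x.2, x.1⟫_ℂ = ⟪x.1, x.2⟫_ℂ := by
    have hc : IsClosed {x : H × H | ⟪x.2, x.1⟫_ℂ = ⟪x.1, x.2⟫_ℂ} :=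
      isClosed_eq (by fun_prop) (by fun_prop)
    have hs : G ⊆ {x : H × H | ⟪x.2, x.1⟫_ℂ = ⟪x.1, x.2⟫_ℂ} := by
      intro x hx
      have h := subset_closure hx
      rw [hG] at h
      exact h x hx
    exact fun x hx => closure_minimal hs hc hx
  have h2 := hsub _ h1
  simp only [inner_smul_left, inner_smul_right, map_neg, hk] at h2
  have h3 : (2 * k) * ⟪g, g⟫_ℂ = 0 := by linear_combination h2
  rcases mul_eq_zero.mp h3 with h | h
  · exact absurd h (mul_ne_zero two_ne_zero hk0)
  · exact inner_self_eq_zero.mp h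

/-- Algebraic core: first factorization. -/
lemma resolvent_factor {H : Type*} [NormedAddCommGroup H] [InnerProductSpace ℂ H]
    (A B : H →ₗ.[ℂ] H) (u v : ℂ) (RA RB : H →L[ℂ] H)
    (hRA : IsResolventAt A u RA) (hRB : IsResolventAt B v RB) (f : H)
    (hfB : f ∈ B.domain) (hfA : f ∈ A.domain) (hBf : B ⟨f, hfB⟩ ∈ A.domain) :
    RB (RA (A ⟨B ⟨f, hfB⟩, hBf⟩ - v • A ⟨f, hfA⟩ - u • B ⟨f, hfB⟩ + (u * v) • f)) = f := by
  have h1 := hRA.2 (⟨B ⟨f, hfB⟩, hBf⟩ - v • ⟨f, hfA⟩)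
  have h2 := hRB.2 ⟨f, hfB⟩
  rw [LinearPMap.map_sub, LinearPMap.map_smul] at h1
  have h3 : A ⟨B ⟨f, hfB⟩, hBf⟩ - v • A ⟨f, hfA⟩ - u • B ⟨f, hfB⟩ + (u * v) • f
    = A ⟨B ⟨f, hfB⟩, hBf⟩ - v • A ⟨f, hfA⟩
      - u • ((⟨B ⟨f, hfB⟩, hBf⟩ - v • ⟨f, hfA⟩ : A.domain) : H) := by
    simp only [Submodule.coe_sub, Submodule.coe_smul]
    module
  rw [h3, h1]
  exact h2

/-- Proposition 2.9. If the symmetric operator `T` of Lemma 2.8 is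
essentially self-adjoint and `ab ≠ 0`, then both resolvent identities hold on all of `H` for
`λ = a q̄^{1/2}`, `μ = b q̄^{1/2}`, and the operator `R_{b q^{1/2}}(B) R_{a q^{1/2}}(A)`
is normal.  (Note `λ q = a q^{1/2}` and `μ q = b q^{1/2}`.) -/
theorem stmt14 {H : Type*} [NormedAddCommGroup H] [InnerProductSpace ℂ H] [CompleteSpace H]
    (A B : H →ₗ.[ℂ] H) (hA : IsSelfAdjoint A) (hB : IsSelfAdjoint B)
    (θ₀ : ℝ) (hθ₀ : 0 < |θ₀|) (hθ₀' : |θ₀| < Real.pi)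
    (a b : ℝ) (hab : a * b ≠ 0)
    (hdense : Dense (qCommSet A B (Complex.exp (-(θ₀ : ℝ) * Complex.I))))
    -- `T` is essentially self-adjoint: the closure of its graph is the graph of its adjoint
    (hT : closure (TGraph A B θ₀ a b) =
      {p : H × H | ∀ (f : H) (hfB : f ∈ B.domain) (hfA : f ∈ A.domain)
        (hBf : B ⟨f, hfB⟩ ∈ A.domain) (hAf : A ⟨f, hfA⟩ ∈ B.domain),
        A ⟨B ⟨f, hfB⟩, hBf⟩ = Complex.exp (-(θ₀ : ℝ) * Complex.I) • B ⟨A ⟨f, hfA⟩, hAf⟩ →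
          ⟪Tval A B θ₀ a b f hfB hfA hBf, p.1⟫_ℂ = ⟪f, p.2⟫_ℂ}) :
    (∃ R, IsResolventAt A ((a : ℂ) * Complex.exp ((θ₀ / 2 : ℝ) * Complex.I)) R)
    ∧ (∃ R, IsResolventAt A ((a : ℂ) * Complex.exp (-(θ₀ / 2 : ℝ) * Complex.I)) R)
    ∧ (∃ R, IsResolventAt B ((b : ℂ) * Complex.exp ((θ₀ / 2 : ℝ) * Complex.I)) R)
    ∧ (∃ R, IsResolventAt B ((b : ℂ) * Complex.exp (-(θ₀ / 2 : ℝ) * Complex.I)) R)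
    ∧ ∀ RA RAq RB RBq : H →L[ℂ] H,
        IsResolventAt A ((a : ℂ) * Complex.exp ((θ₀ / 2 : ℝ) * Complex.I)) RA →
        IsResolventAt A ((a : ℂ) * Complex.exp (-(θ₀ / 2 : ℝ) * Complex.I)) RAq →
        IsResolventAt B ((b : ℂ) * Complex.exp ((θ₀ / 2 : ℝ) * Complex.I)) RB →
        IsResolventAt B ((b : ℂ) * Complex.exp (-(θ₀ / 2 : ℝ) * Complex.I)) RBq →
          (∀ h : H, RA (RB h)
              = Complex.exp (-(θ₀ : ℝ) * Complex.I) • RBq (RAq h)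
                + (((a : ℂ) * (b : ℂ)) * (Complex.exp (-(θ₀ : ℝ) * Complex.I) - 1)) •
                    RBq (RAq (RA (RB h))))
          ∧ (∀ h : H, RA (RB h)
              = Complex.exp (-(θ₀ : ℝ) * Complex.I) • RBq (RAq h)
                + (((a : ℂ) * (b : ℂ)) * (Complex.exp (-(θ₀ : ℝ) * Complex.I) - 1)) •
                    RA (RB (RBq (RAq h))))
          ∧ (RBq ∘L RAq) ∘L ContinuousLinearMap.adjoint (RBq ∘L RAq)
              = ContinuousLinearMap.adjoint (RBq ∘L RAq) ∘L (RBq ∘L RAq) := by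
  have e1 : Complex.exp (-(θ₀ : ℝ) * Complex.I) =
      Complex.exp (-(θ₀ / 2 : ℝ) * Complex.I) * Complex.exp (-(θ₀ / 2 : ℝ) * Complex.I) := by
    rw [← Complex.exp_add]; congr 1; push_cast; ring
  have e2 : Complex.exp ((θ₀ / 2 : ℝ) * Complex.I) * Complex.exp (-(θ₀ / 2 : ℝ) * Complex.I)
      = 1 := by
    rw [← Complex.exp_add]
    simp
  have e3 : (starRingEnd ℂ) (Complex.exp ((θ₀ / 2 : ℝ) * Complex.I)) =
      Complex.exp (-(θ₀ / 2 : ℝ) * Complex.I) := by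
    rw [← Complex.exp_conj, map_mul, Complex.conj_ofReal, Complex.conj_I, mul_neg, neg_mul]
  have hsin : Real.sin (θ₀ / 2) ≠ 0 := by
    have h0 : θ₀ ≠ 0 := abs_pos.mp hθ₀
    have := abs_lt.mp hθ₀'
    intro h
    rw [Real.sin_eq_zero_iff_of_lt_of_lt (by linarith) (by linarith)] at h
    exact h0 (by linarith)
  have i1 : (Complex.exp ((θ₀ / 2 : ℝ) * Complex.I)).im = Real.sin (θ₀ / 2) :=
    Complex.exp_ofReal_mul_I_im _
  have i2 : (Complex.exp (-(θ₀ / 2 : ℝ) * Complex.I)).im = - Real.sin (θ₀ / 2) := by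
    rw [← e3, Complex.conj_im, i1]
  have ha : a ≠ 0 := left_ne_zero_of_mul hab
  have hb : b ≠ 0 := right_ne_zero_of_mul hab
  unfold Tval at hT
  unfold TGraph Tval at hT
  clear hdense
  rw [e1] at hT ⊢
  clear e1
  generalize Complex.exp ((θ₀ / 2 : ℝ) * Complex.I) = P at *
  generalize Complex.exp (-(θ₀ / 2 : ℝ) * Complex.I) = p at *
  have e4 : (starRingEnd ℂ) p = P := by rw [← e3, Complex.conj_conj]
  have hPp : P - p ≠ 0 := by
    intro h
    have := congrArg Complex.im h
    rw [Complex.sub_im, i1, i2] at this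
    simp at this
    exact hsin (by linarith)
  have habC : (a : ℂ) * (b : ℂ) ≠ 0 := by exact_mod_cast hab
  set k : ℂ := ((P - p) / 2) * ((a : ℂ) * (b : ℂ)) with hkdef
  have hk : (starRingEnd ℂ) k = -k := by
    rw [hkdef]
    simp only [map_mul, map_div₀, map_sub, e3, e4, Complex.conj_ofReal, map_ofNat]
    ring
  have hk0 : k ≠ 0 := mul_ne_zero (div_ne_zero hPp two_ne_zero) habC
  refine ⟨selfAdj_resolvent A hA _ ?_, selfAdj_resolvent A hA _ ?_, selfAdj_resolvent B hB _ ?_,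
    selfAdj_resolvent B hB _ ?_, ?_⟩
  · rw [Complex.im_ofReal_mul, i1]; exact mul_ne_zero ha hsin
  · rw [Complex.im_ofReal_mul, i2]; exact mul_ne_zero ha (neg_ne_zero.mpr hsin)
  · rw [Complex.im_ofReal_mul, i1]; exact mul_ne_zero hb hsin
  · rw [Complex.im_ofReal_mul, i2]; exact mul_ne_zero hb (neg_ne_zero.mpr hsin)
  intro RA RAq RB RBq hRA hRAq hRB hRBq
  generalize hGdef : {x : H × H | ∃ (f : H) (hfB : f ∈ B.domain) (hfA : f ∈ A.domain)
      (hBf : B ⟨f, hfB⟩ ∈ A.domain) (hAf : A ⟨f, hfA⟩ ∈ B.domain),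
      A ⟨B ⟨f, hfB⟩, hBf⟩ = (p * p) • B ⟨A ⟨f, hfA⟩, hAf⟩ ∧
      x = (f, P • (A ⟨B ⟨f, hfB⟩, hBf⟩ - ((b : ℂ) * p) • A ⟨f, hfA⟩
        - ((a : ℂ) * p) • B ⟨f, hfB⟩ + ((a : ℂ) * (b : ℂ) * (p * p)) • f) + k • f)} = G at hT
  have hG : closure G = {y : H × H | ∀ x ∈ G, ⟪x.2, y.1⟫_ℂ = ⟪x.1, y.2⟫_ℂ} := by
    rw [hT]
    ext y
    constructor
    · intro h x hx
      rw [← hGdef] at hx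
      obtain ⟨f, hfB, hfA, hBf, hAf, heq, rfl⟩ := hx
      exact h f hfB hfA hBf hAf heq
    · intro h f hfB hfA hBf hAf heq
      refine h (f, _) ?_
      rw [← hGdef]
      exact ⟨f, hfB, hfA, hBf, hAf, heq, rfl⟩
  have hN : ∀ x ∈ G, RBq (RAq (x.2 - k • x.1)) = P • x.1 := by
    intro x hx
    rw [← hGdef] at hx
    obtain ⟨f, hfB, hfA, hBf, hAf, heq, rfl⟩ := hx
    have h := resolvent_factor A B _ _ RAq RBq hRAq hRBq f hfB hfA hBf
    refine Eq.trans ?_ (congrArg (fun y => P • y) h)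
    simp only [add_sub_cancel_right, map_smul]
    rw [show (a : ℂ) * p * (b * p) = a * b * (p * p) by ring]
  have hM : ∀ x ∈ G, RA (RB (x.2 - (-k) • x.1)) = p • x.1 := by
    intro x hx
    rw [← hGdef] at hx
    obtain ⟨f, hfB, hfA, hBf, hAf, heq, rfl⟩ := hx
    have h := resolvent_factor B A _ _ RB RA hRB hRA f hfA hfB hAf
    refine Eq.trans ?_ (congrArg (fun y => p • y) h)
    simp only [← map_smul]
    congr 2
    simp only [heq, hkdef]
    match_scalars
    · linear_combination p * e2
    · linear_combination (0 : ℂ) * e2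
    · linear_combination (0 : ℂ) * e2
    · linear_combination (a * b * (p - P)) * e2
  have hd1 := range_dense G hG k hk hk0
  have hd2 := range_dense G hG (-k) (by rw [map_neg, hk]) (neg_ne_zero.mpr hk0)
  have id1 : ∀ h : H, RA (RB h) = (p * p) • RBq (RAq h)
      + (((a : ℂ) * (b : ℂ)) * (p * p - 1)) • RBq (RAq (RA (RB h))) := by
    have : RA ∘L RB = (p * p) • (RBq ∘L RAq)
        + (((a : ℂ) * (b : ℂ)) * (p * p - 1)) • (RBq ∘L RAq ∘L RA ∘L RB) := by
      refine ContinuousLinearMap.ext_on hd2 ?_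
      rintro _ ⟨x, hx, rfl⟩
      have h1 := hN x hx
      have h2 := hM x hx
      have h3 : RBq (RAq (x.2 - (-k) • x.1)) = P • x.1 + (2 * k) • RBq (RAq x.1) := by
        rw [← h1, ← map_smul, ← map_smul, ← map_add, ← map_add]
        congr 2
        module
      simp only [ContinuousLinearMap.comp_apply, add_apply,
        smul_apply]
      rw [h2, h3]
      simp only [map_smul, hkdef]
      match_scalars
      · linear_combination -p * e2
      · linear_combination -(a * b * p) * e2
    intro h
    exact congrArg (fun F : H →L[ℂ] H => F h) this
  have id2 : ∀ h : H, RA (RB h) = (p * p) • RBq (RAq h)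
      + (((a : ℂ) * (b : ℂ)) * (p * p - 1)) • RA (RB (RBq (RAq h))) := by
    have : RA ∘L RB = (p * p) • (RBq ∘L RAq)
        + (((a : ℂ) * (b : ℂ)) * (p * p - 1)) • (RA ∘L RB ∘L RBq ∘L RAq) := by
      refine ContinuousLinearMap.ext_on hd1 ?_
      rintro _ ⟨x, hx, rfl⟩
      have h1 := hN x hx
      have h2 := hM x hx
      have h3 : RA (RB (x.2 - k • x.1)) = p • x.1 - (2 * k) • RA (RB x.1) := by
        rw [← h2, ← map_smul, ← map_smul, ← map_sub, ← map_sub]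
        congr 2
        module
      simp only [ContinuousLinearMap.comp_apply, add_apply,
        smul_apply]
      rw [h1, h3]
      simp only [map_smul, hkdef]
      match_scalars
      · linear_combination -p * e2
      · linear_combination -(a * b * p) * e2
    intro h
    exact congrArg (fun F : H →L[ℂ] H => F h) this
  refine ⟨id1, id2, ?_⟩
  have cA : (starRingEnd ℂ) ((a : ℂ) * p) = a * P := by
    rw [map_mul, e4, Complex.conj_ofReal]
  have cB : (starRingEnd ℂ) ((b : ℂ) * p) = b * P := by
    rw [map_mul, e4, Complex.conj_ofReal]
  rw [ContinuousLinearMap.adjoint_comp, resolvent_adjoint A hA _ _ cA RAq RA hRAq hRA,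
    resolvent_adjoint B hB _ _ cB RBq RB hRBq hRB]
  ext h
  simp only [ContinuousLinearMap.comp_apply]
  have h1 := (id1 h).symm.trans (id2 h)
  have h2 := add_left_cancel h1
  have hc : ((a : ℂ) * (b : ℂ)) * (p * p - 1) ≠ 0 := by
    refine mul_ne_zero habC ?_
    intro h0
    have : p * (P - p) = 0 := by linear_combination e2 - h0
    rcases mul_eq_zero.mp this with h' | h'
    · rw [h', mul_zero] at e2
      exact zero_ne_one e2
    · exact hPp h'
  exact smul_right_injective H hc h2
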